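/- For every energy h, the energy function E(s,v,u,w) = (1/2)*(v^2*cos(u)^2 + w^2) - (1-s)*W(u) - h*s*cos(u)^2 is smooth on R^4 and its gradient is nonzero at every point of its zero set; consequently the zero level set {E = 0} is a smooth three-dimensional submanifold of R^4. -/

import Mathlib

open Real Filter Topology MeasureTheory

/-- The regularized shape potential `W(u)` of the isosceles three-body problem with
masses `m1 = m2 = 1`, `m3`, where `mu = 2*m3/(2+m3)`. -/
noncomputable def Wpot (m3 u : ℝ) : ℝ :=
  1 / Real.sqrt 2 +
    2 * m3 * Real.cos u ^ 2 /
      Real.sqrt (Real.cos u ^ 4 / 2 + (1 - Real.cos u ^ 4) / (2 * m3 / (2 + m3)))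

/-- The energy function `E(s,v,u,w)` for energy `h`. -/
noncomputable def energyFn (m3 h s v u w : ℝ) : ℝ :=
  1 / 2 * (v ^ 2 * Real.cos u ^ 2 + w ^ 2) - (1 - s) * Wpot m3 u - h * s * Real.cos u ^ 2

/-- `(s,v,u,w) : ℝ → ℝ` is a (globally defined) solution of the regularized blown-up
system of the isosceles three-body problem with mass `m3` and energy `h`. -/
def IsSolution (m3 h : ℝ) (s v u w : ℝ → ℝ) : Prop :=
  (∀ τ : ℝ, HasDerivAt s (v τ * s τ * (1 - s τ) * Real.cos (u τ) ^ 2) τ) ∧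
  (∀ τ : ℝ, HasDerivAt v (1 / 2 * (1 - s τ) * v τ ^ 2 * Real.cos (u τ) ^ 2 + w τ ^ 2
      - (1 - s τ) * Wpot m3 (u τ)) τ) ∧
  (∀ τ : ℝ, HasDerivAt u (1 / 2 * Real.sqrt (1 + Real.cos (u τ) ^ 2) * w τ) τ) ∧
  (∀ τ : ℝ, HasDerivAt w (-(1 / 2) * (1 + s τ) * v τ * w τ * Real.cos (u τ) ^ 2
      + 1 / 2 * Real.sqrt (1 + Real.cos (u τ) ^ 2) * (1 - s τ) * deriv (Wpot m3) (u τ)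
      + 1 / 2 * (v τ ^ 2 - 2 * h * s τ) * Real.sqrt (1 + Real.cos (u τ) ^ 2)
          * Real.sin (u τ) * Real.cos (u τ)) τ)

/-- The solution satisfies the energy relation `E = 0` at all times. -/
def SatisfiesEnergy (m3 h : ℝ) (s v u w : ℝ → ℝ) : Prop :=
  ∀ τ : ℝ, energyFn m3 h (s τ) (v τ) (u τ) (w τ) = 0

/-- A nonzero linear functional on a finite-dimensional space can be completed to a linear
isomorphism by finitely many further coordinates. -/
theorem exists_prod_eq_continuousLinearEquiv {E F : Type*} [NormedAddCommGroup E]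
    [NormedSpace ℝ E] [FiniteDimensional ℝ E] [NormedAddCommGroup F] [NormedSpace ℝ F]
    [FiniteDimensional ℝ F] (hEF : Module.finrank ℝ E = Module.finrank ℝ F + 1)
    (l : E →L[ℝ] ℝ) (hl : l ≠ 0) :
    ∃ (L : E →L[ℝ] F) (A : E ≃L[ℝ] F × ℝ), (A : E →L[ℝ] F × ℝ) = L.prod l := by
  have hl' : (l : E →ₗ[ℝ] ℝ) ≠ 0 := fun h0 => hl (ContinuousLinearMap.coe_injective h0)
  have hker : Module.finrank ℝ (LinearMap.ker (l : E →ₗ[ℝ] ℝ)) = Module.finrank ℝ F := by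
    have h1 := Module.Dual.finrank_ker_add_one_of_ne_zero hl'
    omega
  let e := LinearEquiv.ofFinrankEq (LinearMap.ker (l : E →ₗ[ℝ] ℝ)) F hker
  obtain ⟨g, hg⟩ := LinearMap.exists_extend (e : LinearMap.ker (l : E →ₗ[ℝ] ℝ) →ₗ[ℝ] F)
  have hinj : Function.Injective (g.prod (l : E →ₗ[ℝ] ℝ)) := by
    rw [injective_iff_map_eq_zero]
    intro x hx
    obtain ⟨hgx, hlx⟩ := Prod.ext_iff.mp hx
    have h2 : e ⟨x, hlx⟩ = 0 := (LinearMap.congr_fun hg ⟨x, hlx⟩).symm.trans hgx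
    exact congrArg Subtype.val (e.map_eq_zero_iff.mp h2)
  have hfin : Module.finrank ℝ E = Module.finrank ℝ (F × ℝ) := by simp [hEF]
  refine ⟨LinearMap.toContinuousLinearMap g,
    (LinearEquiv.ofInjectiveOfFinrankEq _ hinj hfin).toContinuousLinearEquiv, ?_⟩
  ext x <;> rfl

/-- A level set of a smooth real function is flattened by a smooth chart near every point at
which the derivative does not vanish. -/
theorem ContDiff.exists_slice_chart {E F : Type*} [NormedAddCommGroup E]
    [NormedSpace ℝ E] [FiniteDimensional ℝ E] [NormedAddCommGroup F] [NormedSpace ℝ F]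
    [FiniteDimensional ℝ F] (hEF : Module.finrank ℝ E = Module.finrank ℝ F + 1)
    {n : WithTop ℕ∞} (hn : n ≠ 0) {f : E → ℝ} (hf : ContDiff ℝ n f) {p : E}
    (hp : fderiv ℝ f p ≠ 0) :
    ∃ φ : OpenPartialHomeomorph E (F × ℝ), p ∈ φ.source ∧ ContDiffOn ℝ n φ φ.source ∧
      ContDiffOn ℝ n φ.symm φ.target ∧ ∀ q, (φ q).2 = f q := by
  have : CompleteSpace E := FiniteDimensional.complete ℝ E
  obtain ⟨L, A, hA⟩ := exists_prod_eq_continuousLinearEquiv hEF _ hp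
  have hG : ContDiff ℝ n fun q => (L q, f q) := L.contDiff.prodMk hf
  have hG' : ∀ q, HasFDerivAt (fun q => (L q, f q)) (L.prod (fderiv ℝ f q)) q := fun q =>
    L.hasFDerivAt.prodMk (hf.differentiable hn q).hasFDerivAt
  have hcont : Continuous fun q => L.prod (fderiv ℝ f q) := by
    have h1 := hG.continuous_fderiv hn
    rwa [funext fun q => (hG' q).fderiv] at h1
  let φ := hG.contDiffAt.toOpenPartialHomeomorph _ (f' := A) (hA ▸ hG' p) hn
  let U : Set E := {q | ∃ B : E ≃L[ℝ] F × ℝ, (B : E →L[ℝ] F × ℝ) = L.prod (fderiv ℝ f q)}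
  have hU : IsOpen U := ContinuousLinearEquiv.isOpen.preimage hcont
  refine ⟨φ.restrOpen U hU, ⟨hG.contDiffAt.mem_toOpenPartialHomeomorph_source _ hn, A, hA⟩,
    hG.contDiffOn, fun y hy => ?_, fun q => rfl⟩
  obtain ⟨-, B, hB⟩ := (φ.restrOpen U hU).map_target hy
  exact ((φ.restrOpen U hU).contDiffAt_symm hy (hB ▸ hG' _) hG.contDiffAt).contDiffWithinAt

theorem contDiff_Wpot {m3 : ℝ} (hm3 : 0 < m3) {n : WithTop ℕ∞} : ContDiff ℝ n (Wpot m3) := by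
  have hpos : ∀ u : ℝ,
      0 < cos u ^ 4 / 2 + (1 - cos u ^ 4) / (2 * m3 / (2 + m3)) := by
    intro u
    have h0 : 0 ≤ cos u ^ 4 := by positivity
    have h1 : cos u ^ 4 ≤ 1 := by nlinarith [cos_sq_le_one u, sq_nonneg (cos u)]
    have hmu : 0 < 2 * m3 / (2 + m3) := by positivity
    rcases h0.eq_or_lt with h | h
    · rw [← h]
      simpa using inv_pos.2 hmu
    · exact add_pos_of_pos_of_nonneg (by positivity) (div_nonneg (by linarith) hmu.le)
  unfold Wpot
  refine contDiff_const.add (ContDiff.div (by fun_prop) (ContDiff.sqrt ?_ fun u => (hpos u).ne')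
    fun u => (sqrt_pos.2 (hpos u)).ne')
  fun_prop

theorem Wpot_pos {m3 : ℝ} (hm3 : 0 < m3) (u : ℝ) : 0 < Wpot m3 u := by
  unfold Wpot
  positivity

theorem contDiff_energyFn {m3 : ℝ} (h : ℝ) (hm3 : 0 < m3) {n : WithTop ℕ∞} :
    ContDiff ℝ n (fun p : ℝ × ℝ × ℝ × ℝ => energyFn m3 h p.1 p.2.1 p.2.2.1 p.2.2.2) := by
  have hW := contDiff_Wpot hm3 (n := n)
  unfold energyFn
  fun_prop

theorem fderiv_energyFn_ne_zero {m3 h : ℝ} (hm3 : 0 < m3) {p : ℝ × ℝ × ℝ × ℝ}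
    (hp : energyFn m3 h p.1 p.2.1 p.2.2.1 p.2.2.2 = 0) :
    fderiv ℝ (fun q : ℝ × ℝ × ℝ × ℝ => energyFn m3 h q.1 q.2.1 q.2.2.1 q.2.2.2) p ≠ 0 := by
  intro h0
  obtain ⟨s, v, u, w⟩ := p
  have hE := ((contDiff_energyFn h hm3 (n := 1)).differentiable one_ne_zero
    (s, v, u, w)).hasFDerivAt
  rw [h0] at hE
  have hs : Wpot m3 u - h * cos u ^ 2 = 0 := by
    have h1 := hE.comp_hasDerivAt s ((hasDerivAt_id s).prodMk (hasDerivAt_const s (v, u, w)))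
    have h2 : HasDerivAt (fun t => energyFn m3 h t v u w)
        (0 - (0 - 1) * Wpot m3 u - h * 1 * cos u ^ 2) s :=
      ((hasDerivAt_const s _).sub
        (((hasDerivAt_const s 1).sub (hasDerivAt_id s)).mul_const _)).sub
        (((hasDerivAt_id s).const_mul h).mul_const _)
    have h3 := h2.unique h1
    simp only [_root_.zero_apply] at h3
    linarith
  have hv : v * cos u ^ 2 = 0 := by
    have h1 := hE.comp_hasDerivAt v ((hasDerivAt_const v s).prodMk
      ((hasDerivAt_id v).prodMk (hasDerivAt_const v (u, w))))
    have h2 : HasDerivAt (fun t => energyFn m3 h s t u w)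
        (1 / 2 * (((2 : ℕ) : ℝ) * v ^ (2 - 1) * cos u ^ 2)) v :=
      (((((hasDerivAt_pow 2 v).mul_const _).add_const _).const_mul (1 / 2)).sub_const _).sub_const _
    have h3 := h2.unique h1
    simp only [_root_.zero_apply] at h3
    norm_num at h3 ⊢
    exact h3
  have hw : w = 0 := by
    have h1 := hE.comp_hasDerivAt w ((hasDerivAt_const w s).prodMk
      ((hasDerivAt_const w v).prodMk ((hasDerivAt_const w u).prodMk (hasDerivAt_id w))))
    have h2 : HasDerivAt (fun t => energyFn m3 h s v u t)
        (1 / 2 * (((2 : ℕ) : ℝ) * w ^ (2 - 1))) w :=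
      ((((hasDerivAt_pow 2 w).const_add _).const_mul (1 / 2)).sub_const _).sub_const _
    have h3 := h2.unique h1
    simpa using h3
  have hWpos := Wpot_pos hm3 u
  simp only [energyFn] at hp
  have hW : Wpot m3 u = 0 := by
    linear_combination -hp + s * hs + v / 2 * hv + w / 2 * hw
  exact hWpos.ne' hW

/-- The energy function `E` is smooth on `ℝ⁴` and its gradient is nonzero at
every point of its zero set; consequently the zero level set `{E = 0}` is a smooth
three-dimensional submanifold of `ℝ⁴` (expressed here via smooth slice charts flattening
the zero set onto `(ℝ × ℝ × ℝ) × {0}`). -/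
theorem stmt0 (m3 h : ℝ) (hm3 : 0 < m3) :
    ContDiff ℝ (⊤ : ℕ∞) (fun p : ℝ × ℝ × ℝ × ℝ => energyFn m3 h p.1 p.2.1 p.2.2.1 p.2.2.2) ∧
    (∀ p : ℝ × ℝ × ℝ × ℝ, energyFn m3 h p.1 p.2.1 p.2.2.1 p.2.2.2 = 0 →
      fderiv ℝ (fun q : ℝ × ℝ × ℝ × ℝ => energyFn m3 h q.1 q.2.1 q.2.2.1 q.2.2.2) p ≠ 0) ∧
    (∀ p : ℝ × ℝ × ℝ × ℝ, energyFn m3 h p.1 p.2.1 p.2.2.1 p.2.2.2 = 0 →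
      ∃ φ : PartialHomeomorph (ℝ × ℝ × ℝ × ℝ) ((ℝ × ℝ × ℝ) × ℝ),
        p ∈ φ.source ∧ ContDiffOn ℝ (⊤ : ℕ∞) (↑φ) φ.source ∧ ContDiffOn ℝ (⊤ : ℕ∞) (↑φ.symm) φ.target ∧
        ∀ q ∈ φ.source,
          (energyFn m3 h q.1 q.2.1 q.2.2.1 q.2.2.2 = 0 ↔ (φ q).2 = 0)) := by
  refine ⟨contDiff_energyFn h hm3, fun p hp => fderiv_energyFn_ne_zero hm3 hp, fun p hp => ?_⟩
  obtain ⟨φ, hpφ, hφ, hφs, hφE⟩ := (contDiff_energyFn h hm3).exists_slice_chart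
    (F := ℝ × ℝ × ℝ) (by simp) (n := (⊤ : ℕ∞)) (by simp) (fderiv_energyFn_ne_zero hm3 hp)
  exact ⟨φ.toPartialHomeomorph, hpφ, hφ, hφs, fun q _ => by rw [← hφE q]; rfl⟩
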